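/- Let d ≥ 1, k ≥ 2, and let P be a d-dimensional k-template of d-tuples of reals. Then χ(L(ℝ^d,P))^{+(d−1)} ≥ 2^{ℵ₀}. -/

import Mathlib

open Cardinal

/-- A hypergraph with vertex type `V` is identified with its set of edges
`E : Set (Set V)`.  It is `κ`-colorable if there is a function from `V` to a
set of cardinality at most `κ` that is not constant on any edge. -/
def HGColorable {V : Type} (E : Set (Set V)) (κ : Cardinal) : Prop :=
  ∃ (α : Type) (φ : V → α), #α ≤ κ ∧ ∀ e ∈ E, ∃ x ∈ e, ∃ y ∈ e, φ x ≠ φ y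

/-- The chromatic number of a hypergraph: the least cardinal `κ` such that it
has a proper `κ`-coloring. -/
noncomputable def chrNum {V : Type} (E : Set (Set V)) : Cardinal :=
  sInf {κ | HGColorable E κ}

/-- `cardSucc κ m = κ^{+m}`, the `m`-fold cardinal successor of `κ`. -/
noncomputable def cardSucc (κ : Cardinal) (m : ℕ) : Cardinal := (Order.succ)^[m] κ

/-- `Q` is a homomorphic image of the set `P` of `d`-tuples: there is a
surjection `f : P → Q` such that `x i = y i` implies `f x i = f y i`. -/
def IsHomImage {d : ℕ} {A : Type} {B : Fin d → Type} (P : Set (Fin d → A))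
    (Q : Set (∀ i, B i)) : Prop :=
  ∃ f : (Fin d → A) → (∀ i, B i),
    Set.MapsTo f P Q ∧ Set.SurjOn f P Q ∧
    ∀ x ∈ P, ∀ y ∈ P, ∀ i, x i = y i → f x i = f y i

/-- The edges of the template hypergraph `L(X, P)` where `X = Π i, B i`:
the `k`-element subsets of the vertex set that are homomorphic images of `P`. -/
def templateEdges (k : ℕ) {d : ℕ} {A : Type} {B : Fin d → Type}
    (P : Set (Fin d → A)) : Set (Set (∀ i, B i)) :=
  {Q | Q.ncard = k ∧ IsHomImage P Q}

/-- `I` is a distinguisher for `P`: any two distinct members of `P` differ at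
some coordinate in `I`. -/
def IsDistinguisher {d : ℕ} {A : Type} (P : Set (Fin d → A)) (I : Finset (Fin d)) : Prop :=
  ∀ x ∈ P, ∀ y ∈ P, x ≠ y → ∃ i ∈ I, x i ≠ y i

/-- `eDim P = e(P)`, the least cardinality of a distinguisher for `P`. -/
noncomputable def eDim {d : ℕ} {A : Type} (P : Set (Fin d → A)) : ℕ :=
  sInf {e | ∃ I : Finset (Fin d), IsDistinguisher P I ∧ I.card = e}

/-- A `d`-dimensional template is simple if for every `m < d` there are
`x, y ∈ P` with `x i = y i` exactly when `i ≠ m`. -/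
def IsSimple {d : ℕ} {A : Type} (P : Set (Fin d → A)) : Prop :=
  ∀ m : Fin d, ∃ x ∈ P, ∃ y ∈ P, ∀ i, (x i = y i ↔ i ≠ m)

/-- The edges of the zero hypergraph of a `(k, n)`-ary real polynomial:
`k`-element subsets `{a_0, …, a_{k-1}}` of `ℝⁿ` with `p(a_0, …, a_{k-1}) = 0`
for some ordering of the elements. -/
def zeroEdges {n k : ℕ} (p : MvPolynomial (Fin k × Fin n) ℝ) :
    Set (Set (Fin n → ℝ)) :=
  {A | ∃ a : Fin k → (Fin n → ℝ), Function.Injective a ∧ A = Set.range a ∧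
        MvPolynomial.eval (fun q => a q.1 q.2) p = 0}

/-- `H₂ = (V₂, E₂)` contains (a copy of) `H₁ = (V₁, E₁)`: some injection
`V₁ → V₂` maps every edge of `H₁` onto an edge of `H₂`. -/
def HGContains {V₁ V₂ : Type} (E₁ : Set (Set V₁)) (E₂ : Set (Set V₂)) : Prop :=
  ∃ f : V₁ → V₂, Function.Injective f ∧ ∀ e ∈ E₁, f '' e ∈ E₂

theorem cardSucc_succ (κ : Cardinal) (n : ℕ) :
    cardSucc κ (n + 1) = Order.succ (cardSucc κ n) :=
  Function.iterate_succ_apply' _ _ _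

theorem cardSucc_mono (n : ℕ) : Monotone fun κ => cardSucc κ n :=
  Order.succ_mono.iterate n

theorem le_cardSucc (κ : Cardinal) (n : ℕ) : κ ≤ cardSucc κ n := by
  induction n with
  | zero => exact le_rfl
  | succ n ih => exact ih.trans (cardSucc_succ κ n ▸ Order.le_succ _)

/-- Polarized partition relation: every coloring of a `d`-th power of a set of size at least
`(#α)^{+d}` with infinite color set `α` is constant on some `m × ⋯ × m` grid. -/
theorem exists_monochromatic_grid {α : Type} [Infinite α] (m d : ℕ) :
    ∀ {X : Type}, cardSucc #α d ≤ #X → ∀ φ : (Fin d → X) → α,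
      ∃ (g : Fin d → Fin m → X) (c : α), (∀ i, Function.Injective (g i)) ∧
        ∀ h : Fin d → Fin m, φ (fun i => g i (h i)) = c := by
  induction d with
  | zero =>
    intro X _ φ
    exact ⟨finZeroElim, φ finZeroElim, fun i => i.elim0,
      fun h => congrArg φ (Subsingleton.elim _ _)⟩
  | succ d ih =>
    intro X hX φ
    rw [cardSucc_succ] at hX
    obtain ⟨T, hT⟩ := Cardinal.le_mk_iff_exists_set.1 ((Order.le_succ _).trans hX)
    have hα : #α ≤ #T := hT ▸ le_cardSucc _ _
    have hinf : ℵ₀ ≤ #T := (Cardinal.aleph0_le_mk α).trans hα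
    choose g c hg hc using fun z : X =>
      ih hT.ge fun x => φ (Fin.cons z fun i => (x i : X))
    have hcard : #((Fin d → Fin m → T) × α) ≤ #T := by
      have h₁ : #(Fin d → Fin m → T) ≤ #T := by
        have h₂ : #(Fin d → Fin m → T) = (#T ^ (m : Cardinal)) ^ (d : Cardinal) := by simp
        rw [h₂]
        exact_mod_cast (Cardinal.power_nat_le_max (n := d)).trans
          (max_le ((Cardinal.power_nat_le_max (n := m)).trans (max_le le_rfl hinf)) hinf)
      rw [Cardinal.mk_prod, Cardinal.lift_id, Cardinal.lift_id]
      exact (mul_le_mul' h₁ hα).trans (Cardinal.mul_eq_self hinf).le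
    have hlt : #((Fin d → Fin m → T) × α) < #X :=
      hcard.trans_lt (Order.succ_le_iff.1 (hT.symm ▸ hX))
    have : Infinite X := Cardinal.infinite_iff.2 (hinf.trans (Cardinal.mk_set_le T))
    obtain ⟨⟨g₀, c₀⟩, hfib⟩ := Cardinal.exists_infinite_fiber (fun z => (g z, c z)) hlt
    obtain ⟨e⟩ : Nonempty (ℕ ↪ ((fun z => (g z, c z)) ⁻¹' {(g₀, c₀)} : Set X)) :=
      ⟨Infinite.natEmbedding _⟩
    have he : ∀ n, g (e n) = g₀ ∧ c (e n) = c₀ := fun n => Prod.mk.inj (e n).2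
    refine ⟨Fin.cons (fun j => e j) fun i j => g₀ i j, c₀, ?_, ?_⟩
    · refine Fin.cases ?_ fun i => ?_
      · intro a b hab
        exact Fin.ext (e.injective (Subtype.ext hab))
      · have := hg (e 0) i
        rw [(he 0).1] at this
        exact Subtype.val_injective.comp this
    · intro h
      have := hc (e (h 0)) fun i => h i.succ
      rw [(he _).1, (he _).2] at this
      refine Eq.trans (congrArg φ (funext fun i => ?_)) this
      refine Fin.cases rfl (fun i => rfl) i

/-- An injective coordinatewise image of a finite template is an edge. -/
theorem image_mem_templateEdges {d k : ℕ} {A : Type} {B : Fin d → Type} {P : Set (Fin d → A)}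
    (hP : P.ncard = k) (g : ∀ i, A → B i)
    (hg : ∀ x ∈ P, ∀ y ∈ P, ∀ i, g i (x i) = g i (y i) → x i = y i) :
    (fun x i => g i (x i)) '' P ∈ templateEdges k (B := B) P := by
  refine ⟨?_, fun x i => g i (x i), Set.mapsTo_image _ _, Set.surjOn_image _ _, ?_⟩
  · rw [Set.InjOn.ncard_image, hP]
    intro x hx y hy hxy
    exact funext fun i => hg x hx y hy i (congrFun hxy i)
  · intro x _ y _ i h
    simp [h]

theorem hGColorable_chrNum {V : Type} {E : Set (Set V)} (hE : ∀ e ∈ E, e.Nontrivial) :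
    HGColorable E (chrNum E) :=
  csInf_mem (s := {κ | HGColorable E κ}) ⟨#V, V, id, le_rfl, fun e he => hE e he⟩

/-- Corollary 1.3: `χ(L(ℝ^d, P))^{+(d-1)} ≥ 2^{ℵ₀}` for any
`d`-dimensional `k`-template `P` of `d`-tuples of reals. -/
theorem statement9 (d k : ℕ) (hd : 1 ≤ d) (hk : 2 ≤ k)
    (P : Set (Fin d → ℝ)) (hP : P.ncard = k) :
    Cardinal.continuum ≤
      cardSucc (chrNum (templateEdges k (B := fun _ : Fin d => ℝ) P)) (d - 1) := by
  have hPfin : P.Finite := Set.finite_of_ncard_ne_zero (by omega)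
  obtain ⟨α, φ, hα, hφ⟩ := hGColorable_chrNum
    (E := templateEdges k (B := fun _ : Fin d => ℝ) P) fun e he => by
      refine (Set.one_lt_ncard_iff_nontrivial_and_finite.1 ?_).1
      rw [he.1]
      omega
  rcases finite_or_infinite α with hfin | hinf
  · exfalso
    obtain ⟨a, ha, b, c, hc⟩ := Combinatorics.exists_mono_homothetic_copy hPfin.toFinset φ
    obtain ⟨_, ⟨x, hx, rfl⟩, _, ⟨y, hy, rfl⟩, hne⟩ := hφ _
      (image_mem_templateEdges hP (fun i t => a • t + b i) fun x _ y _ i h => by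
        simpa [ha.ne'] using h)
    exact hne ((hc x (hPfin.mem_toFinset.2 hx)).trans (hc y (hPfin.mem_toFinset.2 hy)).symm)
  · by_contra! hlt
    obtain ⟨n, rfl⟩ : ∃ n, d = n + 1 := ⟨d - 1, by omega⟩
    have hX : cardSucc #α (n + 1) ≤ #ℝ := by
      rw [cardSucc_succ, Cardinal.mk_real]
      exact Order.succ_le_of_lt ((cardSucc_mono n hα).trans_lt hlt)
    obtain ⟨g, c, hg, hc⟩ := exists_monochromatic_grid k (n + 1) hX φ
    have hidx : ∀ i : Fin (n + 1), ∃ r : ℝ → Fin k, Set.InjOn r ((fun x => x i) '' P) := by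
      intro i
      have hfin : ((fun x : Fin (n + 1) → ℝ => x i) '' P).Finite := hPfin.image _
      have hle : ((fun x : Fin (n + 1) → ℝ => x i) '' P).ncard ≤ (Set.univ : Set (Fin k)).ncard := by
        rw [Set.ncard_univ, Nat.card_fin, ← hP]
        exact Set.ncard_image_le hPfin
      have : Nonempty (Fin k) := ⟨⟨0, by omega⟩⟩
      obtain ⟨r, -, hr⟩ := hfin.exists_injOn_of_encard_le (t := (Set.univ : Set (Fin k))) (by
        rw [← hfin.cast_ncard_eq, ← Set.finite_univ.cast_ncard_eq]
        exact_mod_cast hle)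
      exact ⟨r, hr⟩
    choose r hr using hidx
    obtain ⟨_, ⟨x, hx, rfl⟩, _, ⟨y, hy, rfl⟩, hne⟩ := hφ _
      (image_mem_templateEdges hP (fun i t => g i (r i t)) fun x hx y hy i h =>
        hr i ⟨x, hx, rfl⟩ ⟨y, hy, rfl⟩ (hg i h))
    exact hne ((hc fun i => r i (x i)).trans (hc fun i => r i (y i)).symm)
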